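/- arXiv:2204.05505 — 3 statements merged into one kernel-verified Lean document; each statement's English description precedes it below -/
import Mathlib

section
/- Suppose x and y are units of a ring A and w : ℤ × ℤ → Aˣ is a doubly-indexed family of pairwise commuting units of A satisfying yx = w(1,1)·xy, x·w(s,t) = w(s+1,t)·x, and y·w(s,t) = w(s,t+1)·y for all s,t ∈ ℤ. Then each of the following six pairs (x',y') of units, together with the indicated weights w', satisfies the same three relations (y'x' = w'(1,1)·x'y', x'·w'(s,t) = w'(s+1,t)·x', y'·w'(s,t) = w'(s,t+1)·y' for all s,t ∈ ℤ): (1) (x',y') = (y,x) with w'(s,t) = w(t,s)⁻¹; (2) (x',y') = (x⁻¹,y) with w'(s,t) = w(1-s,t)⁻¹; (3) (x',y') = (x⁻¹, x⁻¹y) with w'(s,t) = w(1-s-t,t)⁻¹; (4) (x',y') = (x, y⁻¹) with w'(s,t) = w(s,1-t)⁻¹; (5) (x',y') = (x⁻¹, y⁻¹) with w'(s,t) = w(1-s,1-t); (6) (x',y') = (y⁻¹x, y⁻¹) with w'(s,t) = w(s,1-s-t)⁻¹. -/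
/-- The three weight-dependent commutation relations between units `x`, `y`
and the doubly-indexed family of weights `w`. -/
def WeightRel {A : Type*} [Ring A] (x y : Aˣ) (w : ℤ × ℤ → Aˣ) : Prop :=
  y * x = w (1, 1) * x * y ∧
  (∀ s t : ℤ, x * w (s, t) = w (s + 1, t) * x) ∧
  (∀ s t : ℤ, y * w (s, t) = w (s, t + 1) * y)

theorem WeightRel.swap {A : Type*} [Ring A] {x y : Aˣ} {w : ℤ × ℤ → Aˣ}
    (h : WeightRel x y w) : WeightRel y x (fun p => (w (p.2, p.1))⁻¹) := by
  obtain ⟨hyx, hx, hy⟩ := h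
  refine ⟨?_, fun s t => ?_, fun s t => ?_⟩
  · simp [mul_assoc, hyx]
  · exact SemiconjBy.inv_right (hy t s)
  · exact SemiconjBy.inv_right (hx t s)

theorem WeightRel.inv_left {A : Type*} [Ring A] {x y : Aˣ} {w : ℤ × ℤ → Aˣ}
    (h : WeightRel x y w) : WeightRel x⁻¹ y (fun p => (w (1 - p.1, p.2))⁻¹) := by
  obtain ⟨hyx, hx, hy⟩ := h
  refine ⟨?_, fun s t => ?_, fun s t => SemiconjBy.inv_right (hy (1 - s) t)⟩
  · have h01 : x * w (0, 1) = w (1, 1) * x := hx 0 1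
    rw [← h01] at hyx
    rw [mul_inv_eq_iff_eq_mul, mul_assoc, mul_assoc, hyx]
    simp [mul_assoc]
  · have hs : SemiconjBy x (w (1 - (s + 1), t)) (w (1 - s, t)) := by
      have := hx (1 - (s + 1)) t
      rwa [show 1 - (s + 1) + 1 = 1 - s by ring] at this
    exact hs.inv_symm_left.inv_right

theorem WeightRel.mul_right {A : Type*} [Ring A] {x y : Aˣ} {w : ℤ × ℤ → Aˣ}
    (h : WeightRel x y w) : WeightRel x (x * y) (fun p => w (p.1 + p.2, p.2)) := by
  obtain ⟨hyx, hx, hy⟩ := h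
  refine ⟨?_, fun s t => ?_, fun s t => ?_⟩
  · have h11 : x * w (1, 1) = w (1 + 1, 1) * x := hx 1 1
    simp only [mul_assoc, hyx]
    rw [← mul_assoc, h11, mul_assoc]
  · simpa only [add_right_comm] using hx (s + t) t
  · have hs := SemiconjBy.mul_left (hx (s + t) (t + 1)) (hy (s + t) t)
    rwa [add_assoc] at hs

/-- Lemma 2.2 (involutions): each of the six pairs `(x',y')` with the indicated
weights `w'` again satisfies the commutation relations. -/
theorem six_involutions {A : Type*} [Ring A] (x y : Aˣ) (w : ℤ × ℤ → Aˣ)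
    (hcomm : ∀ p q : ℤ × ℤ, Commute (w p) (w q))
    (hrel : WeightRel x y w) :
    WeightRel y x (fun p => (w (p.2, p.1))⁻¹) ∧
    WeightRel x⁻¹ y (fun p => (w (1 - p.1, p.2))⁻¹) ∧
    WeightRel x⁻¹ (x⁻¹ * y) (fun p => (w (1 - p.1 - p.2, p.2))⁻¹) ∧
    WeightRel x y⁻¹ (fun p => (w (p.1, 1 - p.2))⁻¹) ∧
    WeightRel x⁻¹ y⁻¹ (fun p => w (1 - p.1, 1 - p.2)) ∧
    WeightRel (y⁻¹ * x) y⁻¹ (fun p => (w (p.1, 1 - p.1 - p.2))⁻¹) := by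
  have h_inv_right {x y : Aˣ} {w : ℤ × ℤ → Aˣ} (h : WeightRel x y w) :
      WeightRel x y⁻¹ (fun p => (w (p.1, 1 - p.2))⁻¹) := by
    simpa using h.swap.inv_left.swap
  have h_inv_mul {x y : Aˣ} {w : ℤ × ℤ → Aˣ} (h : WeightRel x y w) :
      WeightRel x⁻¹ (x⁻¹ * y) (fun p => (w (1 - p.1 - p.2, p.2))⁻¹) := by
    simpa only [sub_sub] using h.inv_left.mul_right
  refine ⟨hrel.swap, hrel.inv_left, h_inv_mul hrel, h_inv_right hrel, ?_, ?_⟩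
  · simpa using (h_inv_right hrel).inv_left
  · simpa [sub_right_comm] using (h_inv_mul hrel.swap).swap
end

section
/- For all integers k and ℓ, one has y^k x^ℓ = (∏_{i=1}^{ℓ} ∏_{j=1}^{k} w(i,j)) · x^ℓ y^k, equivalently y^k x^ℓ = (∏_{i=1}^{ℓ} W(i,k)) · x^ℓ y^k, where W(i,k) := ∏_{j=1}^{k} w(i,j), and all products over integer ranges use the extended convention: ∏_{j=l}^{m} A_j equals A_l A_{l+1} ⋯ A_m if m ≥ l, equals 1 if m = l-1, and equals A_{l-1}^{-1} A_{l-2}^{-1} ⋯ A_{m+1}^{-1} if m < l-1. -/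
/-- Ordered product `f l * f (l+1) * ⋯ * f m` (equal to `1` when `m < l`). -/
def nprod {M : Type*} [Monoid M] (f : ℤ → M) (l m : ℤ) : M :=
  ((List.range (m + 1 - l).toNat).map fun i => f (l + i)).prod

/-- Extended product over an integer range: for `m ≥ l - 1` it is the ordered
product `f l ⋯ f m` (empty when `m = l - 1`), and for `m < l - 1` it is
`(f (l-1))⁻¹ (f (l-2))⁻¹ ⋯ (f (m+1))⁻¹`. -/
def zprodG {G : Type*} [Group G] (f : ℤ → G) (l m : ℤ) : G :=
  if l ≤ m + 1 then nprod f l m else (nprod f (m + 1) (l - 1))⁻¹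

/-- The big weights `W(s,t) = ∏_{j=1}^{t} w(s,j)` (extended convention). -/
def bigWnc {A : Type*} [Ring A] (w : ℤ × ℤ → Aˣ) (s t : ℤ) : Aˣ :=
  zprodG (fun j => w (s, j)) 1 t

theorem nprod_eq_prod_map_range {M : Type*} [Monoid M] (f : ℤ → M) (l m : ℤ) :
    nprod f l m = ((List.range (m + 1 - l).toNat).map fun i : ℕ => f (l + (i : ℤ))).prod := by
  simp [nprod, ← List.map_eq_flatMap, Function.comp_def]

theorem nprod_succ_left {M : Type*} [Monoid M] (f : ℤ → M) {l m : ℤ} (h : l ≤ m) :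
    nprod f l m = f l * nprod f (l + 1) m := by
  obtain ⟨n, rfl⟩ := Int.le.dest h
  have e1 : (l + n + 1 - l).toNat = n + 1 := by omega
  have e2 : (l + n + 1 - (l + 1)).toNat = n := by omega
  rw [nprod_eq_prod_map_range, nprod_eq_prod_map_range, e1, e2, List.range_succ_eq_map]
  simp [Function.comp_def, add_assoc, add_comm (1 : ℤ)]

theorem nprod_succ_right {M : Type*} [Monoid M] (f : ℤ → M) {l m : ℤ} (h : l ≤ m + 1) :
    nprod f l (m + 1) = nprod f l m * f (m + 1) := by
  rw [nprod_eq_prod_map_range, nprod_eq_prod_map_range]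
  have e : (m + 1 + 1 - l).toNat = (m + 1 - l).toNat + 1 := by omega
  have e' : l + ((m + 1 - l).toNat : ℤ) = m + 1 := by omega
  rw [e, List.range_succ, List.map_append, List.prod_append, List.map_singleton,
    List.prod_singleton, e']

theorem zprodG_self_sub_one {G : Type*} [Group G] (f : ℤ → G) (l : ℤ) :
    zprodG f l (l - 1) = 1 := by
  simp [zprodG, nprod]

theorem zprodG_one_zero {G : Type*} [Group G] (f : ℤ → G) : zprodG f 1 0 = 1 :=
  zprodG_self_sub_one f 1

theorem zprodG_succ {G : Type*} [Group G] (f : ℤ → G) (l m : ℤ) :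
    zprodG f l (m + 1) = zprodG f l m * f (m + 1) := by
  rcases le_or_gt l (m + 1) with h | h
  · rw [zprodG, zprodG, if_pos (by omega), if_pos h, nprod_succ_right f h]
  · have key : zprodG f l m = (nprod f (m + 1) (l - 1))⁻¹ := by
      rw [zprodG, if_neg (by omega)]
    rw [key, nprod_succ_left f (by omega), mul_inv_rev, inv_mul_cancel_right, zprodG]
    split_ifs with h'
    · obtain rfl : l = m + 1 + 1 := by omega
      simp [nprod]
    · rfl

theorem Int.forall_of_iff_succ {p : ℤ → Prop} (h0 : p 0) (hs : ∀ m, p m ↔ p (m + 1)) (m : ℤ) :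
    p m := by
  induction m using Int.induction_on with
  | zero => exact h0
  | succ n ih => exact (hs _).1 ih
  | pred n ih => exact (hs _).2 (by simpa using ih)

theorem Commute.zprodG_right {G : Type*} [Group G] {g : G} {f : ℤ → G}
    (h : ∀ i, Commute g (f i)) (m : ℤ) : Commute g (zprodG f 1 m) := by
  refine Int.forall_of_iff_succ (p := fun m => Commute g (zprodG f 1 m)) ?_ (fun m => ?_) m
  · simp [zprodG_one_zero]
  · rw [zprodG_succ]
    exact ⟨fun hm => hm.mul_right (h _), fun hm => by
      simpa using hm.mul_right (h (m + 1)).inv_right⟩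

theorem SemiconjBy.zprodG_right {G : Type*} [Group G] {g : G} {f f' : ℤ → G}
    (h : ∀ i, SemiconjBy g (f i) (f' i)) (m : ℤ) :
    SemiconjBy g (zprodG f 1 m) (zprodG f' 1 m) := by
  refine Int.forall_of_iff_succ
    (p := fun m => SemiconjBy g (zprodG f 1 m) (zprodG f' 1 m)) ?_ (fun m => ?_) m
  · simp [zprodG_one_zero]
  · rw [zprodG_succ, zprodG_succ]
    exact ⟨fun hm => hm.mul_right (h _), fun hm => by
      simpa using hm.mul_right (h (m + 1)).inv_right⟩

theorem SemiconjBy.zpow_left_of_shift {G : Type*} [Group G] {g : G} {f : ℤ → G}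
    (h : ∀ i, SemiconjBy g (f i) (f (i + 1))) (n i : ℤ) :
    SemiconjBy (g ^ n) (f i) (f (i + n)) := by
  refine Int.forall_of_iff_succ
    (p := fun n => SemiconjBy (g ^ n) (f i) (f (i + n))) ?_ (fun n => ?_) n
  · simp
  · rw [add_comm n 1, zpow_one_add, add_comm 1 n, ← add_assoc]
    exact ⟨fun hn => (h _).mul_left hn, fun hn => by
      simpa using (SemiconjBy.inv_symm_left (h (i + n))).mul_left hn⟩

theorem zpow_mul_eq_zprodG_mul {G : Type*} [Group G] {x y : G} {f : ℤ → G}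
    (hcomm : ∀ i j, Commute (f i) (f j)) (hyx : y * x = f 1 * x * y)
    (hy : ∀ j, SemiconjBy y (f j) (f (j + 1))) (k : ℤ) :
    y ^ k * x = zprodG f 1 k * x * y ^ k := by
  refine Int.forall_of_iff_succ
    (p := fun k => y ^ k * x = zprodG f 1 k * x * y ^ k) ?_ (fun k => ?_) k
  · simp [zprodG_one_zero]
  · have e1 : y ^ (k + 1) * x = f (k + 1) * (y ^ k * x) * y := by
      have h := (SemiconjBy.zpow_left_of_shift hy k 1).eq
      rw [add_comm 1 k] at h
      rw [zpow_add_one, mul_assoc, hyx, ← mul_assoc (f (k + 1)), ← h]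
      simp only [mul_assoc]
    have e2 : zprodG f 1 (k + 1) * x * y ^ (k + 1)
        = f (k + 1) * (zprodG f 1 k * x * y ^ k) * y := by
      rw [zprodG_succ, ← (Commute.zprodG_right (hcomm (k + 1)) k).eq, zpow_add_one]
      simp only [mul_assoc]
    rw [e1, e2, mul_left_inj, mul_right_inj]

theorem mul_zpow_eq_zprodG_mul {G : Type*} [Group G] {x z : G} {f : ℤ → G}
    (hzx : z * x = f 1 * x * z) (hx : ∀ i, SemiconjBy x (f i) (f (i + 1))) (l : ℤ) :
    z * x ^ l = zprodG f 1 l * x ^ l * z := by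
  refine Int.forall_of_iff_succ
    (p := fun l => z * x ^ l = zprodG f 1 l * x ^ l * z) ?_ (fun l => ?_) l
  · simp [zprodG_one_zero]
  · have e : zprodG f 1 (l + 1) * x ^ (l + 1) * z = zprodG f 1 l * x ^ l * z * x := by
      have h := (SemiconjBy.zpow_left_of_shift hx l 1).eq
      rw [add_comm 1 l] at h
      rw [mul_assoc _ z x, hzx, zprodG_succ, zpow_add_one, mul_assoc (zprodG f 1 l),
        ← mul_assoc (f (l + 1)), ← h]
      simp only [mul_assoc]
    rw [e, zpow_add_one, ← mul_assoc, mul_left_inj]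

/-- Lemma 2.4: for all integers `k`, `ℓ` one has
`y^k x^ℓ = (∏_{i=1}^{ℓ} ∏_{j=1}^{k} w(i,j)) x^ℓ y^k
         = (∏_{i=1}^{ℓ} W(i,k)) x^ℓ y^k`. -/
theorem weight_commutation {A : Type*} [Ring A] (x y : Aˣ) (w : ℤ × ℤ → Aˣ)
    (hcomm : ∀ p q : ℤ × ℤ, Commute (w p) (w q))
    (h1 : y * x = w (1, 1) * x * y)
    (h2 : ∀ s t : ℤ, x * w (s, t) = w (s + 1, t) * x)
    (h3 : ∀ s t : ℤ, y * w (s, t) = w (s, t + 1) * y)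
    (k l : ℤ) :
    y ^ k * x ^ l = zprodG (fun i => zprodG (fun j => w (i, j)) 1 k) 1 l * x ^ l * y ^ k ∧
    y ^ k * x ^ l = zprodG (fun i => bigWnc w i k) 1 l * x ^ l * y ^ k := by
  have key : y ^ k * x ^ l =
      zprodG (fun i => zprodG (fun j => w (i, j)) 1 k) 1 l * x ^ l * y ^ k :=
    mul_zpow_eq_zprodG_mul (f := fun i => zprodG (fun j => w (i, j)) 1 k)
      (zpow_mul_eq_zprodG_mul (fun _ _ => hcomm _ _) h1 (fun t => h3 1 t) k)
      (fun i => SemiconjBy.zprodG_right (fun t => h2 i t) k) l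
  exact ⟨key, key⟩
end

section
/- Let A be a ring with units x, y and pairwise commuting weights w : ℤ × ℤ → Aˣ satisfying the commutation relations, and let B(n,k) ∈ A for n,k ≥ 0 be defined by B(n,0) = 1 for all n ≥ 0, B(n,k) = 0 for k > n or k < 0, and B(n+1,k) = B(n,k) + B(n,k-1)·W(k, n+1-k), where W(s,t) := ∏_{j=1}^{t} w(s,j). Then for every natural number n, (x+y)^n = ∑_{k=0}^{n} B(n,k) · x^k y^{n-k}. -/
theorem bigWnc_zero {A : Type*} [Ring A] (w : ℤ × ℤ → Aˣ) (s : ℤ) : bigWnc w s 0 = 1 := by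
  simp [bigWnc, zprodG, nprod]

theorem bigWnc_natCast_succ {A : Type*} [Ring A] (w : ℤ × ℤ → Aˣ) (s : ℤ) (m : ℕ) :
    bigWnc w s (m + 1 : ℕ) = bigWnc w s m * w (s, m + 1) := by
  have toNat_sub (t : ℕ) : ((t : ℤ) + 1 - 1).toNat = t := by omega
  have one_le (t : ℕ) : (1 : ℤ) ≤ (t : ℤ) + 1 := by omega
  simp only [bigWnc, zprodG, nprod, if_pos (one_le _), toNat_sub]
  rw [List.range_succ]
  simp [add_comm]

theorem commute_bigWnc {A : Type*} [Ring A] {w : ℤ × ℤ → Aˣ} {u : Aˣ} (s : ℤ)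
    (h : ∀ t : ℤ, Commute u (w (s, t))) (m : ℕ) : Commute u (bigWnc w s m) := by
  induction m with
  | zero => simp [bigWnc_zero]
  | succ m ih =>
    rw [bigWnc_natCast_succ]
    exact ih.mul_right (h _)

theorem pow_mul_bigWnc {A : Type*} [Ring A] {x : Aˣ} {w : ℤ × ℤ → Aˣ}
    (h : ∀ s t : ℤ, x * w (s, t) = w (s + 1, t) * x) (k : ℕ) (s : ℤ) (m : ℕ) :
    x ^ k * bigWnc w s m = bigWnc w (s + k) m * x ^ k := by
  have step (s : ℤ) : x * bigWnc w s m = bigWnc w (s + 1) m * x := by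
    induction m with
    | zero => simp [bigWnc_zero]
    | succ m ih =>
      rw [bigWnc_natCast_succ, bigWnc_natCast_succ, ← mul_assoc, ih, mul_assoc, h, mul_assoc]
  induction k generalizing s with
  | zero => simp
  | succ k ih =>
    rw [pow_succ, mul_assoc, step, ← mul_assoc, ih, mul_assoc]
    push_cast
    rw [add_assoc, add_comm (1 : ℤ)]

theorem pow_mul_weight {A : Type*} [Ring A] {y : Aˣ} {w : ℤ × ℤ → Aˣ}
    (h : ∀ s t : ℤ, y * w (s, t) = w (s, t + 1) * y) (m : ℕ) (s t : ℤ) :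
    y ^ m * w (s, t) = w (s, t + m) * y ^ m := by
  induction m with
  | zero => simp
  | succ m ih =>
    rw [pow_succ', mul_assoc, ih, ← mul_assoc, h, mul_assoc]
    push_cast
    rw [add_assoc]

theorem pow_mul_eq_bigWnc_mul {A : Type*} [Ring A] {x y : Aˣ} {w : ℤ × ℤ → Aˣ}
    (hcomm : ∀ p q : ℤ × ℤ, Commute (w p) (w q))
    (h1 : y * x = w (1, 1) * x * y)
    (h3 : ∀ s t : ℤ, y * w (s, t) = w (s, t + 1) * y) (m : ℕ) :
    y ^ m * x = bigWnc w 1 m * x * y ^ m := by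
  induction m with
  | zero => simp [bigWnc_zero]
  | succ m ih =>
    calc y ^ (m + 1) * x = y ^ m * w (1, 1) * x * y := by
          rw [pow_succ, mul_assoc, h1]; simp only [mul_assoc]
      _ = w (1, m + 1) * (y ^ m * x) * y := by
          rw [pow_mul_weight h3, add_comm (1 : ℤ)]; simp only [mul_assoc]
      _ = w (1, m + 1) * bigWnc w 1 m * x * y ^ (m + 1) := by
          rw [ih, pow_succ]; simp only [mul_assoc]
      _ = bigWnc w 1 (m + 1 : ℕ) * x * y ^ (m + 1) := by
          rw [bigWnc_natCast_succ, (commute_bigWnc 1 (fun t => hcomm _ (1, t)) m).eq]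

theorem pow_mul_pow_mul_eq {A : Type*} [Ring A] {x y : Aˣ} {w : ℤ × ℤ → Aˣ}
    (hcomm : ∀ p q : ℤ × ℤ, Commute (w p) (w q))
    (h1 : y * x = w (1, 1) * x * y)
    (h2 : ∀ s t : ℤ, x * w (s, t) = w (s + 1, t) * x)
    (h3 : ∀ s t : ℤ, y * w (s, t) = w (s, t + 1) * y) (k m : ℕ) :
    x ^ k * y ^ m * x = bigWnc w (k + 1) m * x ^ (k + 1) * y ^ m := by
  rw [mul_assoc, pow_mul_eq_bigWnc_mul hcomm h1 h3, ← mul_assoc, ← mul_assoc,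
    pow_mul_bigWnc h2, add_comm (1 : ℤ), pow_succ]
  simp only [mul_assoc]

/-- Weight-dependent binomial theorem (Theorem 2.7): with the weight-dependent
binomial coefficients `B` defined by the recursion, for every natural number `n`,
`(x+y)^n = ∑_{k=0}^{n} B(n,k) x^k y^{n-k}`. -/
theorem weight_binomial_theorem {A : Type*} [Ring A] (x y : Aˣ) (w : ℤ × ℤ → Aˣ)
    (hcomm : ∀ p q : ℤ × ℤ, Commute (w p) (w q))
    (h1 : y * x = w (1, 1) * x * y)
    (h2 : ∀ s t : ℤ, x * w (s, t) = w (s + 1, t) * x)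
    (h3 : ∀ s t : ℤ, y * w (s, t) = w (s, t + 1) * y)
    (B : ℤ → ℤ → A)
    (hB0 : ∀ n : ℤ, 0 ≤ n → B n 0 = 1)
    (hBzero : ∀ n k : ℤ, 0 ≤ n → (n < k ∨ k < 0) → B n k = 0)
    (hBrec : ∀ n k : ℤ, 0 ≤ n →
      B (n + 1) k = B n k + B n (k - 1) * (bigWnc w k (n + 1 - k) : A))
    (n : ℕ) :
    ((x : A) + (y : A)) ^ n =
      ∑ k ∈ Finset.range (n + 1), B n k * (x : A) ^ k * (y : A) ^ (n - k) := by
  induction n with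
  | zero => simp [hB0]
  | succ n ih =>
    have mul_x (k : ℕ) (hk : k ∈ Finset.range (n + 1)) :
        B n k * (x : A) ^ k * (y : A) ^ (n - k) * x =
          B n k * (bigWnc w (k + 1) (n - k) : A) * (x : A) ^ (k + 1) * (y : A) ^ (n - k) := by
      have hkn : k ≤ n := Nat.lt_succ_iff.mp (Finset.mem_range.mp hk)
      have h := congrArg (Units.val : Aˣ → A) (pow_mul_pow_mul_eq hcomm h1 h2 h3 k (n - k))
      simp only [Units.val_mul, Units.val_pow_eq_pow_val, Nat.cast_sub hkn] at h
      simpa only [mul_assoc] using congrArg (B n k * ·) h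
    have mul_y (k : ℕ) (hk : k ∈ Finset.range (n + 1)) :
        B n k * (x : A) ^ k * (y : A) ^ (n - k) * y =
          B n k * (x : A) ^ k * (y : A) ^ (n + 1 - k) := by
      rw [Nat.succ_sub (Nat.lt_succ_iff.mp (Finset.mem_range.mp hk)), pow_succ]
      simp only [mul_assoc]
    have expand (k : ℕ) :
        B (n + 1 : ℕ) (k + 1 : ℕ) * (x : A) ^ (k + 1) * (y : A) ^ (n + 1 - (k + 1)) =
          B n (k + 1 : ℕ) * (x : A) ^ (k + 1) * (y : A) ^ (n + 1 - (k + 1)) +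
          B n k * (bigWnc w (k + 1) (n - k) : A) * (x : A) ^ (k + 1) * (y : A) ^ (n - k) := by
      push_cast
      rw [hBrec n _ (Int.natCast_nonneg n), add_sub_cancel_right, add_sub_add_right_eq_sub,
        add_mul, add_mul]
    have top : B n (n + 1 : ℕ) = 0 := hBzero _ _ (Int.natCast_nonneg n) (Or.inl (by simp))
    rw [pow_succ, ih, mul_add, Finset.sum_mul, Finset.sum_mul, Finset.sum_congr rfl mul_x,
      Finset.sum_congr rfl mul_y, Finset.sum_range_succ' _ (n + 1),
      Finset.sum_congr rfl fun k _ => expand k, Finset.sum_add_distrib,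
      Finset.sum_range_succ (fun k => B n (k + 1 : ℕ) * (x : A) ^ (k + 1) *
        (y : A) ^ (n + 1 - (k + 1))) n, top, zero_mul, zero_mul, add_zero,
      Finset.sum_range_succ' (fun k => B n k * (x : A) ^ k * (y : A) ^ (n + 1 - k)) n]
    simp only [Nat.cast_zero, hB0 _ (Int.natCast_nonneg _)]
    abel
end
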